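/- Let λ ∈ (0,1) and let ζ ∈ 𝔻 with ζ ≠ λ. There exists a constant d = d(λ,ζ) > 0, depending only on λ and ζ, such that for every integer n ≥ 1 there is a norm on ℂⁿ whose induced operator norm ‖·‖ satisfies ‖T_λ‖ ≤ 1 and |b_λ(ζ)|ⁿ · ‖(ζI − T_λ)⁻¹‖ ≥ d·√n, where b_λ(z) = (z−λ)/(1−λz) and I is the n×n identity matrix. -/

import Mathlib

/-- The lower-triangular Toeplitz matrix `T_λ`: diagonal entries λ, entries
(1 − |λ|²)·(−conj λ)^(i−j−1) below the diagonal, and 0 above the diagonal. -/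
noncomputable def ToeplitzTlam (n : ℕ) (lam : ℂ) : Matrix (Fin n) (Fin n) ℂ :=
  fun i j =>
    if (i : ℕ) = (j : ℕ) then lam
    else if (j : ℕ) < (i : ℕ) then
      ((1 - ‖lam‖ ^ 2 : ℝ) : ℂ) * (-(starRingEnd ℂ) lam) ^ ((i : ℕ) - (j : ℕ) - 1)
    else 0

open Real

theorem integral_abs_deriv_div_le {P P' : ℝ → ℝ} (hP : ∀ t, HasDerivAt P (P' t) t)
    (hP'c : Continuous P') (hpos : ∀ t ∈ Set.Icc 0 π, 0 ≤ P' t)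
    (hneg : ∀ t ∈ Set.Icc π (2 * π), P' t ≤ 0) (k m : ℕ) :
    ∫ t in (0 : ℝ)..2 * π, k * |P' t| / ((k * P t - m) ^ 2 + (m + 1)) ≤ 2 * π / √(m + 1) := by
  have hPc : Continuous P := continuous_iff_continuousAt.2 fun t => (hP t).continuousAt
  have hn : (0 : ℝ) < m + 1 := by positivity
  have hD : ∀ t, (k * P t - m) ^ 2 + ((m : ℝ) + 1) ≠ 0 := fun t => by positivity
  have hs : 0 < √((m : ℝ) + 1) := Real.sqrt_pos.2 hn
  have hss : √((m : ℝ) + 1) ^ 2 = m + 1 := Real.sq_sqrt hn.le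
  have hA : ∀ t, HasDerivAt (fun t => arctan ((k * P t - m) / √(m + 1)) / √(m + 1))
      (k * P' t / ((k * P t - m) ^ 2 + (m + 1))) t := fun t => by
    have h := ((((hP t).const_mul (k : ℝ)).sub_const (m : ℝ)).div_const
      (√((m : ℝ) + 1))).arctan.div_const (√((m : ℝ) + 1))
    refine h.congr_deriv ?_
    rw [div_pow, hss]
    field_simp
    rw [hss]
    field_simp
    ring
  have hc : Continuous fun t => k * |P' t| / ((k * P t - m) ^ 2 + ((m : ℝ) + 1)) := by
    fun_prop (disch := exact hD)
  have hc' : Continuous fun t => k * P' t / ((k * P t - m) ^ 2 + ((m : ℝ) + 1)) := by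
    fun_prop (disch := exact hD)
  have hleft : ∫ t in (0 : ℝ)..π, k * |P' t| / ((k * P t - m) ^ 2 + ((m : ℝ) + 1)) =
      ∫ t in (0 : ℝ)..π, k * P' t / ((k * P t - m) ^ 2 + ((m : ℝ) + 1)) := by
    refine intervalIntegral.integral_congr fun t ht => ?_
    rw [Set.uIcc_of_le pi_pos.le] at ht
    simp only [abs_of_nonneg (hpos t ht)]
  have hright : ∫ t in π..2 * π, k * |P' t| / ((k * P t - m) ^ 2 + ((m : ℝ) + 1)) =
      ∫ t in π..2 * π, -(k * P' t / ((k * P t - m) ^ 2 + ((m : ℝ) + 1))) := by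
    refine intervalIntegral.integral_congr fun t ht => ?_
    rw [Set.uIcc_of_le (by linarith [pi_pos])] at ht
    simp only [abs_of_nonpos (hneg t ht)]
    ring
  rw [← intervalIntegral.integral_add_adjacent_intervals (hc.intervalIntegrable 0 π)
    (hc.intervalIntegrable π (2 * π)), hleft, hright, intervalIntegral.integral_neg,
    intervalIntegral.integral_eq_sub_of_hasDerivAt (fun t _ => hA t)
      (hc'.intervalIntegrable _ _),
    intervalIntegral.integral_eq_sub_of_hasDerivAt (fun t _ => hA t)
      (hc'.intervalIntegrable _ _)]
  have h1 := arctan_lt_pi_div_two ((k * P π - m) / √((m : ℝ) + 1))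
  have h2 := neg_pi_div_two_lt_arctan ((k * P 0 - m) / √((m : ℝ) + 1))
  have h3 := neg_pi_div_two_lt_arctan ((k * P (2 * π) - m) / √((m : ℝ) + 1))
  rw [← sub_div, ← sub_div, ← sub_eq_add_neg, ← sub_div]
  gcongr
  linarith

theorem exists_norm_integral_oscillatory_le {P P' : ℝ → ℝ} {a a' : ℝ → ℂ} {c : ℝ}
    (hP : ∀ t, HasDerivAt P (P' t) t) (hP'c : Continuous P')
    (hpos : ∀ t ∈ Set.Icc 0 π, 0 ≤ P' t) (hneg : ∀ t ∈ Set.Icc π (2 * π), P' t ≤ 0)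
    (ha : ∀ t, HasDerivAt a (a' t) t) (ha'c : Continuous a')
    (hPper : P (2 * π) = P 0) (haper : a (2 * π) = a 0) (haP : ∀ t, ‖a t‖ ≤ c * |P' t|) :
    ∃ K : ℝ, 0 < K ∧ ∀ k m : ℕ, ∀ E : ℝ → ℂ,
      (∀ t, HasDerivAt E (Complex.I * ((k * P t - m : ℝ) : ℂ) * E t) t) → (∀ t, ‖E t‖ = 1) →
      E (2 * π) = E 0 → ‖∫ t in (0 : ℝ)..2 * π, a t * E t‖ ≤ K / √(m + 1) := by
  have hPc : Continuous P := continuous_iff_continuousAt.2 fun t => (hP t).continuousAt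
  have hac : Continuous a := continuous_iff_continuousAt.2 fun t => (ha t).continuousAt
  obtain ⟨C₁, hC₁⟩ := isCompact_Icc.exists_bound_of_continuousOn
    (s := Set.Icc 0 (2 * π)) hPc.continuousOn
  obtain ⟨C₂, hC₂⟩ := isCompact_Icc.exists_bound_of_continuousOn
    (s := Set.Icc 0 (2 * π)) hac.continuousOn
  obtain ⟨C₃, hC₃⟩ := isCompact_Icc.exists_bound_of_continuousOn
    (s := Set.Icc 0 (2 * π)) ha'c.continuousOn
  obtain ⟨C, hC1, hcC, hC₁C, hC₂C, hC₃C⟩ : ∃ C : ℝ, 1 ≤ C ∧ c ≤ C ∧ C₁ ≤ C ∧ C₂ ≤ C ∧ C₃ ≤ C :=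
    ⟨max 1 (max c (max C₁ (max C₂ C₃))), by simp, by simp, by simp, by simp, by simp⟩
  refine ⟨2 * π * (C ^ 2 + 4 * C), by positivity, fun k m E hE hE1 hEper => ?_⟩
  set n : ℝ := m + 1 with hn_def
  have hn : 1 ≤ n := by simp [hn_def]
  have hn0 : 0 < n := by linarith
  have hs : 1 ≤ √n := Real.one_le_sqrt.2 hn
  have hss : √n ^ 2 = n := Real.sq_sqrt hn0.le
  have hD : ∀ t, 0 < (k * P t - m) ^ 2 + n := fun t => by positivity
  have hEc : Continuous E := continuous_iff_continuousAt.2 fun t => (hE t).continuousAt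
  have hφ : ∀ t, HasDerivAt (fun t => k * P t - m) (k * P' t) t := fun t =>
    ((hP t).const_mul (k : ℝ)).sub_const (m : ℝ)
  have hq : ∀ t, HasDerivAt (fun t => (k * P t - m) / ((k * P t - m) ^ 2 + n))
      (k * P' t * (n - (k * P t - m) ^ 2) / ((k * P t - m) ^ 2 + n) ^ 2) t := fun t => by
    have h := (hφ t).div (((hφ t).pow 2).add_const n) (hD t).ne'
    refine h.congr_deriv ?_
    simp
    ring
  have hH : ∀ t, HasDerivAt
      (fun t => a t * (((k * P t - m) / ((k * P t - m) ^ 2 + n) : ℝ) : ℂ) * E t)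
      (Complex.I * (a t * E t) - E t * (Complex.I * a t * ((n / ((k * P t - m) ^ 2 + n) : ℝ) : ℂ)
        - a' t * (((k * P t - m) / ((k * P t - m) ^ 2 + n) : ℝ) : ℂ)
        - a t * ((k * P' t * (n - (k * P t - m) ^ 2) / ((k * P t - m) ^ 2 + n) ^ 2 : ℝ) : ℂ))) t := by
    intro t
    have h := ((ha t).mul (hq t).ofReal_comp).mul (hE t)
    refine h.congr_deriv ?_
    have hid : ((n / ((k * P t - m) ^ 2 + n) : ℝ) : ℂ) = 1 -
        (((k * P t - m) / ((k * P t - m) ^ 2 + n) : ℝ) : ℂ) * ((k * P t - m : ℝ) : ℂ) := by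
      rw [← Complex.ofReal_mul, ← Complex.ofReal_one, ← Complex.ofReal_sub]
      congr 1
      have := (hD t).ne'
      field_simp
      ring
    rw [hid, Pi.mul_apply]
    ring
  set R : ℝ → ℂ := fun t =>
    E t * (Complex.I * a t * ((n / ((k * P t - m) ^ 2 + n) : ℝ) : ℂ)
        - a' t * (((k * P t - m) / ((k * P t - m) ^ 2 + n) : ℝ) : ℂ)
        - a t * ((k * P' t * (n - (k * P t - m) ^ 2) / ((k * P t - m) ^ 2 + n) ^ 2 : ℝ) : ℂ))
    with hR
  have hRc : Continuous R := by
    have h1 : Continuous fun t => n / ((k * P t - m) ^ 2 + n) := by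
      fun_prop (disch := exact fun t => (hD t).ne')
    have h2 : Continuous fun t => (k * P t - m) / ((k * P t - m) ^ 2 + n) := by
      fun_prop (disch := exact fun t => (hD t).ne')
    have h3 : Continuous fun t =>
        k * P' t * (n - (k * P t - m) ^ 2) / ((k * P t - m) ^ 2 + n) ^ 2 := by
      fun_prop (disch := exact fun t => pow_ne_zero 2 (hD t).ne')
    rw [hR]
    exact hEc.mul ((((continuous_const.mul hac).mul (Complex.continuous_ofReal.comp h1)).sub
      (ha'c.mul (Complex.continuous_ofReal.comp h2))).sub
      (hac.mul (Complex.continuous_ofReal.comp h3)))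
  have hint : Complex.I * ∫ t in (0 : ℝ)..2 * π, a t * E t = ∫ t in (0 : ℝ)..2 * π, R t := by
    have hc : Continuous fun t => Complex.I * (a t * E t) := by fun_prop
    have h := intervalIntegral.integral_eq_sub_of_hasDerivAt (a := 0) (b := 2 * π)
      (fun t _ => hH t) ((hc.sub hRc).intervalIntegrable _ _)
    rw [intervalIntegral.integral_sub (hc.intervalIntegrable _ _) (hRc.intervalIntegrable _ _),
      intervalIntegral.integral_const_mul] at h
    rw [hPper, haper, hEper, sub_self] at h
    exact sub_eq_zero.1 h
  have hbound : ∀ t ∈ Set.Icc 0 (2 * π),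
      ‖R t‖ ≤ (C ^ 2 + C) * (k * |P' t| / ((k * P t - m) ^ 2 + n)) + 3 * C / √n := by
    intro t ht
    have hPt : |P t| ≤ C := (hC₁ t ht).trans hC₁C
    have hat : ‖a t‖ ≤ C := (hC₂ t ht).trans hC₂C
    have ha't : ‖a' t‖ ≤ C := (hC₃ t ht).trans hC₃C
    have haPt : ‖a t‖ ≤ C * |P' t| := (haP t).trans (by gcongr)
    have hDt := hD t
    set φ : ℝ := k * P t - m with hφ_def
    have hφD : |φ| / (φ ^ 2 + n) ≤ 1 / √n := by
      rw [div_le_div_iff₀ hDt (by positivity)]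
      nlinarith [sq_nonneg (|φ| - √n), sq_abs φ]
    have h1D : 1 / (φ ^ 2 + n) ≤ 1 / √n := by
      gcongr
      nlinarith [sq_nonneg φ]
    have hnD : n / (φ ^ 2 + n) ≤ C * (k / (φ ^ 2 + n)) + 2 / √n := by
      have hn_le : n ≤ C * k + |φ| + 1 := by
        have h1 : (k : ℝ) * P t ≤ C * k := by
          rw [mul_comm]; gcongr; exact (le_abs_self _).trans hPt
        have h2 : -φ ≤ |φ| := neg_le_abs φ
        rw [hφ_def] at h2 ⊢
        linarith
      calc n / (φ ^ 2 + n) ≤ (C * k + |φ| + 1) / (φ ^ 2 + n) := by gcongr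
        _ = C * (k / (φ ^ 2 + n)) + |φ| / (φ ^ 2 + n) + 1 / (φ ^ 2 + n) := by ring
        _ ≤ C * (k / (φ ^ 2 + n)) + 1 / √n + 1 / √n := by gcongr
        _ = _ := by ring
    have h3 : |(k * P' t * (n - φ ^ 2) / (φ ^ 2 + n) ^ 2)| ≤ k * |P' t| / (φ ^ 2 + n) := by
      rw [abs_div, abs_mul, abs_mul, Nat.abs_cast, abs_of_pos (pow_pos hDt 2), sq (φ ^ 2 + n),
        ← div_div]
      gcongr
      rw [mul_div_assoc]
      refine mul_le_of_le_one_right (by positivity) ?_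
      rw [div_le_one hDt, abs_le]
      constructor <;> nlinarith [sq_nonneg φ]
    calc ‖R t‖ ≤ ‖a t‖ * (n / (φ ^ 2 + n)) + ‖a' t‖ * (|φ| / (φ ^ 2 + n))
          + ‖a t‖ * |(k * P' t * (n - φ ^ 2) / (φ ^ 2 + n) ^ 2)| := by
          rw [hR]
          simp only [norm_mul, hE1, one_mul]
          refine (norm_sub_le _ _).trans (add_le_add ((norm_sub_le _ _).trans ?_) ?_)
          · rw [norm_mul, norm_mul, norm_mul, Complex.norm_I, one_mul, Complex.norm_real,
              Complex.norm_real, Real.norm_eq_abs, Real.norm_eq_abs, abs_div, abs_div,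
              abs_of_pos hDt, abs_of_pos hn0]
          · rw [norm_mul, Complex.norm_real, Real.norm_eq_abs]
      _ ≤ ‖a t‖ * (C * (k / (φ ^ 2 + n)) + 2 / √n) + C * (1 / √n)
          + C * (k * |P' t| / (φ ^ 2 + n)) := by gcongr
      _ = ‖a t‖ * (C * (k / (φ ^ 2 + n))) + ‖a t‖ * (2 / √n) + C * (1 / √n)
          + C * (k * |P' t| / (φ ^ 2 + n)) := by ring
      _ ≤ (C * |P' t|) * (C * (k / (φ ^ 2 + n))) + C * (2 / √n) + C * (1 / √n)
          + C * (k * |P' t| / (φ ^ 2 + n)) := by gcongr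
      _ = _ := by ring
  have hgc : Continuous fun t => k * |P' t| / ((k * P t - m) ^ 2 + n) := by
    fun_prop (disch := exact fun t => (hD t).ne')
  have h2pi : (0 : ℝ) ≤ 2 * π := by positivity
  calc ‖∫ t in (0 : ℝ)..2 * π, a t * E t‖ = ‖∫ t in (0 : ℝ)..2 * π, R t‖ := by
        rw [← hint, norm_mul, Complex.norm_I, one_mul]
    _ ≤ ∫ t in (0 : ℝ)..2 * π,
        ((C ^ 2 + C) * (k * |P' t| / ((k * P t - m) ^ 2 + n)) + 3 * C / √n) := by
        refine intervalIntegral.norm_integral_le_of_norm_le h2pi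
          (Filter.Eventually.of_forall fun t ht => hbound t (Set.Ioc_subset_Icc_self ht)) ?_
        exact ((continuous_const.mul hgc).add continuous_const).intervalIntegrable _ _
    _ = (C ^ 2 + C) * (∫ t in (0 : ℝ)..2 * π, k * |P' t| / ((k * P t - m) ^ 2 + n))
        + 2 * π * (3 * C / √n) := by
        rw [intervalIntegral.integral_add ((hgc.const_mul _).intervalIntegrable _ _)
          (continuous_const.intervalIntegrable _ _), intervalIntegral.integral_const_mul]
        simp
        ring
    _ ≤ (C ^ 2 + C) * (2 * π / √n) + 2 * π * (3 * C / √n) := by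
        gcongr
        exact integral_abs_deriv_div_le hP hP'c hpos hneg k m
    _ = _ := by ring

theorem HasDerivAt.pow_of_eq_mul {f : ℝ → ℂ} {c : ℂ} {t : ℝ} (h : HasDerivAt f (c * f t) t)
    (k : ℕ) : HasDerivAt (fun t => f t ^ k) (k * c * f t ^ k) t := by
  refine (h.fun_pow k).congr_deriv ?_
  cases k with
  | zero => simp
  | succ k => simp; ring

theorem one_add_mul_ne_zero {lam : ℝ} (hlam : lam ∈ Set.Ioo (0 : ℝ) 1) {z : ℂ} (hz : ‖z‖ ≤ 1) :
    1 + (lam : ℂ) * z ≠ 0 := by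
  intro h
  have h1 : ‖(lam : ℂ) * z‖ = 1 := by
    rw [eq_neg_of_add_eq_zero_right h, norm_neg, norm_one]
  rw [norm_mul, Complex.norm_real, Real.norm_of_nonneg hlam.1.le] at h1
  nlinarith [hlam.1, hlam.2]

theorem one_sub_mul_ne_zero {lam : ℝ} (hlam : lam ∈ Set.Ioo (0 : ℝ) 1) {z : ℂ} (hz : ‖z‖ ≤ 1) :
    1 - (lam : ℂ) * z ≠ 0 := by
  have h := one_add_mul_ne_zero hlam (z := -z) (by rwa [norm_neg])
  rwa [mul_neg, ← sub_eq_add_neg] at h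

theorem add_ne_zero_of_norm_eq_one {lam : ℝ} (hlam : lam ∈ Set.Ioo (0 : ℝ) 1) {z : ℂ}
    (hz : ‖z‖ = 1) : (lam : ℂ) + z ≠ 0 := by
  intro h
  rw [eq_neg_of_add_eq_zero_right h, norm_neg, Complex.norm_real,
    Real.norm_of_nonneg hlam.1.le] at hz
  exact hlam.2.ne hz

/-- The Blaschke factor with zero `-lam`. -/
noncomputable def diskFactor (lam : ℝ) (z : ℂ) : ℂ := (lam + z) / (1 + lam * z)

theorem differentiableOn_diskFactor {lam : ℝ} (hlam : lam ∈ Set.Ioo (0 : ℝ) 1) :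
    DifferentiableOn ℂ (diskFactor lam) (Metric.closedBall 0 1) := by
  refine DifferentiableOn.div (by fun_prop) (by fun_prop) fun z hz => ?_
  exact one_add_mul_ne_zero hlam (by simpa using hz)

theorem norm_diskFactor {lam : ℝ} (hlam : lam ∈ Set.Ioo (0 : ℝ) 1) {z : ℂ} (hz : ‖z‖ = 1) :
    ‖diskFactor lam z‖ = 1 := by
  have h : (lam : ℂ) + z = z * (starRingEnd ℂ) (1 + lam * z) := by
    have hzz : z * (starRingEnd ℂ) z = 1 := by
      rw [Complex.mul_conj, Complex.normSq_eq_norm_sq, hz]; simp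
    simp only [map_add, map_one, map_mul, Complex.conj_ofReal]
    linear_combination -(lam : ℂ) * hzz
  rw [diskFactor, norm_div, h, norm_mul, hz, one_mul, RCLike.norm_conj, div_self]
  exact norm_ne_zero_iff.2 (one_add_mul_ne_zero hlam hz.le)

theorem ofReal_cos_eq_circleMap (t : ℝ) :
    (Real.cos t : ℂ) = (circleMap 0 1 t + (circleMap 0 1 t)⁻¹) / 2 := by
  simp [circleMap, Complex.cos, ← Complex.exp_neg]

theorem one_sub_circleMap_sq (t : ℝ) :
    1 - circleMap 0 1 t ^ 2 = -(2 * Complex.I) * circleMap 0 1 t * (Real.sin t : ℂ) := by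
  have h : Complex.exp (t * Complex.I) ≠ 0 := Complex.exp_ne_zero _
  simp only [circleMap, Complex.ofReal_sin, Complex.sin, Complex.ofReal_one, one_mul, zero_add,
    neg_mul, Complex.exp_neg]
  field_simp
  rw [Complex.I_sq]
  ring

/-- The `m`-th Fourier coefficient of `f` on the unit circle, times `2πi`. -/
noncomputable def circleCoeff (f : ℂ → ℂ) (m : ℤ) : ℂ := ∮ z in C(0, 1), f z * z ^ (-(m + 1))

theorem exists_norm_circleCoeff_le {lam : ℝ} (hlam : lam ∈ Set.Ioo (0 : ℝ) 1) :
    ∃ K : ℝ, 0 < K ∧ ∀ k m : ℕ,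
      ‖circleCoeff (fun z => diskFactor lam z ^ k * ((1 - z ^ 2) / (1 + lam * z))) m‖ ≤
        K / √(m + 1) := by
  obtain ⟨h0, h1⟩ := hlam
  have hs1 : ∀ t, ‖circleMap 0 1 t‖ = 1 := fun t => by simp
  have hs0 : ∀ t, circleMap 0 1 t ≠ 0 := fun t => circleMap_ne_center one_ne_zero
  have hden : ∀ t, 1 + (lam : ℂ) * circleMap 0 1 t ≠ 0 := fun t =>
    one_add_mul_ne_zero ⟨h0, h1⟩ (hs1 t).le
  have hnum : ∀ t, (lam : ℂ) + circleMap 0 1 t ≠ 0 := fun t =>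
    add_ne_zero_of_norm_eq_one ⟨h0, h1⟩ (hs1 t)
  have hs : ∀ t, HasDerivAt (circleMap 0 1) (circleMap 0 1 t * Complex.I) t :=
    hasDerivAt_circleMap 0 1
  have hsc : Continuous (circleMap 0 1) := continuous_circleMap 0 1
  have hQ : ∀ t, 0 < 1 + lam ^ 2 + 2 * lam * cos t := fun t => by
    nlinarith [neg_one_le_cos t, sq_pos_of_pos (sub_pos.2 h1)]
  have hQ4 : ∀ t, 1 + lam ^ 2 + 2 * lam * cos t ≤ 4 := fun t => by
    nlinarith [cos_le_one t]
  have hl : 0 < 1 - lam ^ 2 := by nlinarith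
  have hsper : circleMap 0 1 (2 * π) = circleMap 0 1 0 := by simp [circleMap]
  have hP : ∀ t, HasDerivAt (fun t => (1 - lam ^ 2) / (1 + lam ^ 2 + 2 * lam * cos t))
      ((1 - lam ^ 2) * (2 * lam * sin t) / (1 + lam ^ 2 + 2 * lam * cos t) ^ 2) t := fun t => by
    have h := (hasDerivAt_const t (1 - lam ^ 2)).div
      (((hasDerivAt_cos t).const_mul (2 * lam)).const_add (1 + lam ^ 2)) (hQ t).ne'
    refine h.congr_deriv ?_
    ring
  have ha : ∀ t, HasDerivAt
      (fun t => Complex.I * ((1 - circleMap 0 1 t ^ 2) / (1 + lam * circleMap 0 1 t)))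
      (Complex.I * ((-(2 * circleMap 0 1 t * (circleMap 0 1 t * Complex.I)) *
        (1 + lam * circleMap 0 1 t) - (1 - circleMap 0 1 t ^ 2) *
        (lam * (circleMap 0 1 t * Complex.I))) / (1 + lam * circleMap 0 1 t) ^ 2)) t := fun t => by
    have h := ((((hs t).fun_pow 2).const_sub 1).div
      (((hs t).const_mul (lam : ℂ)).const_add 1) (hden t)).const_mul Complex.I
    refine h.congr_deriv ?_
    simp
  obtain ⟨K, hK, hbound⟩ := exists_norm_integral_oscillatory_le
    (c := 2 / (1 - lam) * 16 / ((1 - lam ^ 2) * (2 * lam))) hP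
    (by fun_prop (disch := exact fun t => pow_ne_zero 2 (hQ t).ne'))
    (fun t ht => by
      have := sin_nonneg_of_nonneg_of_le_pi ht.1 ht.2
      positivity)
    (fun t ht => by
      have h : sin t ≤ 0 := by
        have := sin_nonneg_of_nonneg_of_le_pi (x := t - π) (by linarith [ht.1])
          (by linarith [ht.2])
        rw [sin_sub_pi] at this
        linarith
      refine div_nonpos_of_nonpos_of_nonneg ?_ (by positivity)
      exact mul_nonpos_of_nonneg_of_nonpos hl.le
        (mul_nonpos_of_nonneg_of_nonpos (by positivity) h))
    ha (by fun_prop (disch := exact fun t => pow_ne_zero 2 (hden t))) (by simp)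
    (by simp only [hsper]) (fun t => by
      have hd : 1 - lam ≤ ‖1 + (lam : ℂ) * circleMap 0 1 t‖ := by
        have h := norm_sub_norm_le (1 : ℂ) (-((lam : ℂ) * circleMap 0 1 t))
        rw [norm_neg, norm_mul, hs1, Complex.norm_real, Real.norm_of_nonneg h0.le, norm_one,
          mul_one, sub_neg_eq_add] at h
        exact h
      rw [norm_mul, norm_div, one_sub_circleMap_sq, norm_mul, norm_mul, hs1, Complex.norm_real,
        abs_div, abs_mul, abs_mul, abs_of_pos hl, abs_of_pos (by positivity : 0 < 2 * lam),
        abs_of_pos (pow_pos (hQ t) 2), Real.norm_eq_abs]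
      simp only [Complex.norm_I, norm_neg, norm_mul, Complex.norm_ofNat, one_mul, mul_one]
      have h1l : 0 < 1 - lam := by linarith
      have hQ16 : (1 + lam ^ 2 + 2 * lam * cos t) ^ 2 ≤ 16 := by
        nlinarith [hQ t, hQ4 t]
      calc 2 * |sin t| / ‖1 + (lam : ℂ) * circleMap 0 1 t‖ ≤ 2 * |sin t| / (1 - lam) := by gcongr
        _ = 2 / (1 - lam) * 16 / ((1 - lam ^ 2) * (2 * lam)) *
            ((1 - lam ^ 2) * (2 * lam * |sin t|) / 16) := by field_simp
        _ ≤ _ := by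
          have := hQ t
          gcongr)
  refine ⟨K, hK, fun k m => ?_⟩
  have hE : ∀ t, HasDerivAt
      (fun t => diskFactor lam (circleMap 0 1 t) ^ k * (circleMap 0 1 t)⁻¹ ^ m)
      (Complex.I * ((k * ((1 - lam ^ 2) / (1 + lam ^ 2 + 2 * lam * cos t)) - m : ℝ) : ℂ) *
        (diskFactor lam (circleMap 0 1 t) ^ k * (circleMap 0 1 t)⁻¹ ^ m)) t := fun t => by
    have hB : HasDerivAt (fun t => diskFactor lam (circleMap 0 1 t))
        (Complex.I * (((1 - lam ^ 2) / (1 + lam ^ 2 + 2 * lam * cos t) : ℝ) : ℂ) *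
          diskFactor lam (circleMap 0 1 t)) t := by
      have h := ((hs t).const_add (lam : ℂ)).div (((hs t).const_mul (lam : ℂ)).const_add 1) (hden t)
      refine h.congr_deriv ?_
      have hcos : ((1 + lam ^ 2 + 2 * lam * cos t : ℝ) : ℂ) =
          (1 + lam * circleMap 0 1 t) * (lam + circleMap 0 1 t) / circleMap 0 1 t := by
        push_cast
        rw [← Complex.ofReal_cos, ofReal_cos_eq_circleMap]
        have := hs0 t
        field_simp
        ring
      rw [Complex.ofReal_div, hcos, diskFactor]
      have h1 := hs0 t
      have h2 := hden t
      have h3 := hnum t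
      push_cast
      field_simp
      ring
    have hi : HasDerivAt (fun t => (circleMap 0 1 t)⁻¹)
        (-Complex.I * (circleMap 0 1 t)⁻¹) t := by
      refine ((hs t).fun_inv (hs0 t)).congr_deriv ?_
      have := hs0 t
      field_simp
    refine ((hB.pow_of_eq_mul k).mul (hi.pow_of_eq_mul m)).congr_deriv ?_
    push_cast
    ring
  have hb := hbound k m _ hE (fun t => by
    rw [norm_mul, norm_pow, norm_pow, norm_inv, hs1, norm_diskFactor ⟨h0, h1⟩ (hs1 t)]
    simp) (by simp only [hsper])
  convert hb using 2
  rw [circleCoeff, circleIntegral]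
  refine intervalIntegral.integral_congr fun t _ => ?_
  simp only [deriv_circleMap, smul_eq_mul]
  rw [← Int.natCast_succ, zpow_neg, zpow_natCast, Nat.succ_eq_add_one, pow_succ, inv_pow]
  have := hs0 t
  field_simp
  ring

theorem circleCoeff_congr {f g : ℂ → ℂ} (h : ∀ z, ‖z‖ = 1 → f z = g z) (m : ℤ) :
    circleCoeff f m = circleCoeff g m :=
  circleIntegral.integral_congr zero_le_one fun z hz => by
    simp only [h z (by simpa using hz)]

theorem circleIntegrable_mul_zpow {f : ℂ → ℂ} (hf : ContinuousOn f (Metric.sphere 0 1)) (m : ℤ) :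
    CircleIntegrable (fun z => f z * z ^ m) 0 1 := by
  refine ContinuousOn.circleIntegrable zero_le_one (hf.mul ?_)
  refine (continuousOn_id.zpow₀ m fun z hz => Or.inl ?_)
  rintro rfl
  simp at hz

theorem circleCoeff_affine_mul {f : ℂ → ℂ} (hf : ContinuousOn f (Metric.sphere 0 1)) (p q : ℂ)
    (m : ℤ) : circleCoeff (fun z => (p + q * z) * f z) m =
      p * circleCoeff f m + q * circleCoeff f (m - 1) := by
  simp only [circleCoeff]
  rw [← circleIntegral.integral_const_mul, ← circleIntegral.integral_const_mul,
    ← circleIntegral.integral_add]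
  · refine circleIntegral.integral_congr zero_le_one fun z hz => ?_
    have hz0 : z ≠ 0 := by
      rintro rfl
      simp at hz
    have h : z ^ (-(m - 1 + 1)) = z * z ^ (-(m + 1)) := by
      rw [← zpow_one_add₀ hz0]
      congr 1
      ring
    simp only [h]
    ring
  · exact (circleIntegrable_mul_zpow hf _).const_smul (a := p)
  · exact (circleIntegrable_mul_zpow hf _).const_smul (a := q)

theorem circleCoeff_neg_one {f : ℂ → ℂ} (hf : DifferentiableOn ℂ f (Metric.closedBall 0 1)) :
    circleCoeff f (-1) = 0 := by
  simp only [circleCoeff, neg_add_cancel, neg_zero, zpow_zero, mul_one]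
  exact (hf.diffContOnCl_ball subset_rfl).circleIntegral_eq_zero zero_le_one

theorem norm_circleCoeff_le {f : ℂ → ℂ} {C : ℝ} (hf : ∀ z, ‖z‖ = 1 → ‖f z‖ ≤ C) (m : ℤ) :
    ‖circleCoeff f m‖ ≤ 2 * π * C := by
  have h := circleIntegral.norm_integral_le_of_norm_le_const (c := 0) (R := 1)
    (f := fun z => f z * z ^ (-(m + 1))) (C := C) zero_le_one fun z hz => by
      have hz1 : ‖z‖ = 1 := by simpa using hz
      simpa [hz1] using hf z hz1
  simpa [circleCoeff] using h

theorem circleCoeff_pow (j : ℕ) (m : ℤ) :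
    circleCoeff (fun z => z ^ j) m = if m = j then 2 * π * Complex.I else 0 := by
  have h : circleCoeff (fun z => z ^ j) m = ∮ z in C(0, 1), (z - 0) ^ ((j : ℤ) - m - 1) := by
    refine circleIntegral.integral_congr zero_le_one fun z hz => ?_
    have hz0 : z ≠ 0 := by
      rintro rfl
      simp at hz
    simp only [sub_zero]
    rw [← zpow_natCast, ← zpow_add₀ hz0]
    congr 1
    ring
  rw [h]
  split_ifs with hm
  · subst hm
    simp only [sub_self, zero_sub, zpow_neg_one]
    exact circleIntegral.integral_sub_center_inv 0 one_ne_zero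
  · exact circleIntegral.integral_sub_zpow_of_ne (by omega) _ _ _

theorem toeplitz_mulVec_eq {lam : ℝ} {u v : ℤ → ℂ} (hu : u (-1) = 0) (hv : v (-1) = 0)
    (h : ∀ m : ℕ, u m + lam * u (m - 1) = lam * v m + v (m - 1)) (n : ℕ) :
    (ToeplitzTlam n (lam : ℂ)).mulVec (fun i : Fin n => v (i : ℕ)) = fun i : Fin n => u (i : ℕ) := by
  have hsum : ∀ m : ℕ, u m = lam * v m +
      ∑ j ∈ Finset.range m, (1 - (lam : ℂ) ^ 2) * (-(lam : ℂ)) ^ (m - j - 1) * v j := by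
    intro m
    induction m with
    | zero => simpa [hu, hv] using h 0
    | succ m ih =>
      have hm := h (m + 1)
      have hshift : ∑ j ∈ Finset.range m,
          (1 - (lam : ℂ) ^ 2) * (-(lam : ℂ)) ^ (m + 1 - j - 1) * v j =
          -(lam : ℂ) * ∑ j ∈ Finset.range m,
            (1 - (lam : ℂ) ^ 2) * (-(lam : ℂ)) ^ (m - j - 1) * v j := by
        rw [Finset.mul_sum]
        refine Finset.sum_congr rfl fun j hj => ?_
        have hj : m + 1 - j - 1 = (m - j - 1) + 1 := by
          have := Finset.mem_range.1 hj
          omega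
        rw [hj, pow_succ]
        ring
      rw [Finset.sum_range_succ, hshift]
      push_cast at hm ⊢
      simp only [add_sub_cancel_right] at hm
      simp only [add_tsub_cancel_left, tsub_self, pow_zero]
      linear_combination hm - lam * ih
  ext i
  rw [hsum i, Matrix.mulVec, dotProduct]
  simp only [ToeplitzTlam]
  rw [Fin.sum_univ_eq_sum_range (fun j => (if (i : ℕ) = j then (lam : ℂ)
    else if j < (i : ℕ) then ((1 - ‖(lam : ℂ)‖ ^ 2 : ℝ) : ℂ) *
      (-(starRingEnd ℂ) (lam : ℂ)) ^ ((i : ℕ) - j - 1) else 0) * v j) n,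
    ← Finset.sum_subset (Finset.range_mono i.is_lt), Finset.sum_range_succ, add_comm]
  · congr 1
    · simp
    · refine Finset.sum_congr rfl fun j hj => ?_
      have hj := Finset.mem_range.1 hj
      rw [if_neg hj.ne', if_pos hj]
      simp [← Complex.ofReal_pow]
  · intro j _ hj
    have hj : (i : ℕ) < j := by simpa using hj
    rw [if_neg hj.ne, if_neg (by omega), zero_mul]

theorem toeplitz_mulVec_circleCoeff {lam : ℝ} (hlam : lam ∈ Set.Ioo (0 : ℝ) 1) {f : ℂ → ℂ}
    (hf : DifferentiableOn ℂ f (Metric.closedBall 0 1)) (n : ℕ) :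
    (ToeplitzTlam n (lam : ℂ)).mulVec (fun i : Fin n => circleCoeff f (i : ℕ)) =
      fun i : Fin n => circleCoeff (fun z => diskFactor lam z * f z) (i : ℕ) := by
  have hg := (differentiableOn_diskFactor hlam).fun_mul hf
  refine toeplitz_mulVec_eq (circleCoeff_neg_one hg) (circleCoeff_neg_one hf) (fun m => ?_) n
  have hsub := Metric.sphere_subset_closedBall (x := (0 : ℂ)) (ε := 1)
  have h1 := circleCoeff_affine_mul (hg.continuousOn.mono hsub) 1 lam m
  have h2 := circleCoeff_affine_mul (hf.continuousOn.mono hsub) lam 1 m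
  rw [one_mul] at h1 h2
  rw [← h1, ← h2]
  refine circleCoeff_congr (fun z hz => ?_) _
  have := one_add_mul_ne_zero hlam hz.le
  rw [diskFactor]
  field_simp

theorem toeplitz_pow_mulVec_circleCoeff {lam : ℝ} (hlam : lam ∈ Set.Ioo (0 : ℝ) 1) {f : ℂ → ℂ}
    (hf : DifferentiableOn ℂ f (Metric.closedBall 0 1)) (n k : ℕ) :
    (ToeplitzTlam n (lam : ℂ) ^ k).mulVec (fun i : Fin n => circleCoeff f (i : ℕ)) =
      fun i : Fin n => circleCoeff (fun z => diskFactor lam z ^ k * f z) (i : ℕ) := by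
  induction k with
  | zero => simp
  | succ k ih =>
    rw [pow_succ', ← Matrix.mulVec_mulVec, ih, toeplitz_mulVec_circleCoeff hlam
      (((differentiableOn_diskFactor hlam).fun_pow k).fun_mul hf)]
    simp only [← mul_assoc, ← pow_succ']

theorem circleCoeff_fun_sum {ι : Type*} (s : Finset ι) {f : ι → ℂ → ℂ}
    (hf : ∀ j, ContinuousOn (f j) (Metric.sphere 0 1)) (m : ℤ) :
    circleCoeff (fun z => ∑ j ∈ s, f j z) m = ∑ j ∈ s, circleCoeff (f j) m := by
  simp only [circleCoeff, Finset.sum_mul]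
  exact circleIntegral.integral_fun_sum fun j _ => circleIntegrable_mul_zpow (hf j) _

theorem exists_circleCoeff_eq {n : ℕ} (v : Fin n → ℂ) :
    ∃ f : ℂ → ℂ, Differentiable ℂ f ∧ v = fun i : Fin n => circleCoeff f (i : ℕ) := by
  refine ⟨fun z => ∑ j : Fin n, v j / (2 * π * Complex.I) * z ^ (j : ℕ), by fun_prop, ?_⟩
  ext i
  rw [circleCoeff_fun_sum _ (fun j => by fun_prop)]
  have h : ∀ j : Fin n, circleCoeff (fun z => v j / (2 * π * Complex.I) * z ^ (j : ℕ)) (i : ℕ) =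
      v j / (2 * π * Complex.I) * if i = j then 2 * π * Complex.I else 0 := fun j => by
    have := circleCoeff_pow j (i : ℕ)
    simp only [Nat.cast_inj, Fin.val_inj] at this
    rw [← this]
    simp only [circleCoeff, mul_assoc, circleIntegral.integral_const_mul]
  simp only [h]
  simp

theorem exists_norm_toeplitz_pow_mulVec_le {lam : ℝ} (hlam : lam ∈ Set.Ioo (0 : ℝ) 1) {n : ℕ}
    (v : Fin n → ℂ) :
    ∃ M : ℝ, ∀ (k : ℕ) (i : Fin n), ‖(ToeplitzTlam n (lam : ℂ) ^ k).mulVec v i‖ ≤ M := by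
  obtain ⟨f, hf, rfl⟩ := exists_circleCoeff_eq v
  obtain ⟨C, hC⟩ := (isCompact_sphere (0 : ℂ) 1).exists_bound_of_continuousOn
    hf.continuous.continuousOn
  refine ⟨2 * π * C, fun k i => ?_⟩
  rw [toeplitz_pow_mulVec_circleCoeff hlam hf.differentiableOn]
  refine norm_circleCoeff_le (fun z hz => ?_) _
  rw [norm_mul, norm_pow, norm_diskFactor hlam hz, one_pow, one_mul]
  exact hC z (by simpa using hz)

/-- The supremum over the orbit `A ^ k *ᵥ v` of the absolute value of the `i`-th coordinate. -/
noncomputable def orbitSeminorm {n : ℕ} (A : Matrix (Fin n) (Fin n) ℂ) (i : Fin n)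
    (hA : ∀ v, ∃ M : ℝ, ∀ k : ℕ, ‖(A ^ k).mulVec v i‖ ≤ M) : Seminorm ℂ (Fin n → ℂ) :=
  have hbdd : ∀ v, BddAbove (Set.range fun k : ℕ => ‖(A ^ k).mulVec v i‖) := fun v => by
    obtain ⟨M, hM⟩ := hA v
    exact ⟨M, Set.forall_mem_range.2 hM⟩
  Seminorm.of (fun v => ⨆ k : ℕ, ‖(A ^ k).mulVec v i‖)
    (fun v w => ciSup_le fun k => by
      rw [Matrix.mulVec_add]
      exact (norm_add_le _ _).trans (add_le_add (le_ciSup (hbdd v) k) (le_ciSup (hbdd w) k)))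
    (fun c v => by
      rw [Real.mul_iSup_of_nonneg (norm_nonneg c)]
      simp only [Matrix.mulVec_smul, Pi.smul_apply, norm_smul])

section orbitSeminorm

variable {n : ℕ} {A : Matrix (Fin n) (Fin n) ℂ} {i : Fin n}
  {hA : ∀ v, ∃ M : ℝ, ∀ k : ℕ, ‖(A ^ k).mulVec v i‖ ≤ M}

theorem norm_pow_mulVec_le_orbitSeminorm (v : Fin n → ℂ) (k : ℕ) :
    ‖(A ^ k).mulVec v i‖ ≤ orbitSeminorm A i hA v := by
  obtain ⟨M, hM⟩ := hA v
  exact le_ciSup (f := fun k : ℕ => ‖(A ^ k).mulVec v i‖) ⟨M, Set.forall_mem_range.2 hM⟩ k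

theorem orbitSeminorm_le {v : Fin n → ℂ} {C : ℝ} (h : ∀ k : ℕ, ‖(A ^ k).mulVec v i‖ ≤ C) :
    orbitSeminorm A i hA v ≤ C :=
  ciSup_le h

theorem orbitSeminorm_mulVec_le (v : Fin n → ℂ) :
    orbitSeminorm A i hA (A.mulVec v) ≤ orbitSeminorm A i hA v :=
  orbitSeminorm_le fun k => by
    rw [Matrix.mulVec_mulVec, ← pow_succ]
    exact norm_pow_mulVec_le_orbitSeminorm v (k + 1)

end orbitSeminorm

theorem toeplitz_mulVec_recurrence {lam : ℝ} {n : ℕ} (v : Fin n → ℂ) {j : ℕ} (hj : j + 1 < n) :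
    (ToeplitzTlam n (lam : ℂ)).mulVec v ⟨j + 1, hj⟩ +
      lam * (ToeplitzTlam n (lam : ℂ)).mulVec v ⟨j, by omega⟩ =
    lam * v ⟨j + 1, hj⟩ + v ⟨j, by omega⟩ := by
  have hentry : ∀ l : Fin n, ToeplitzTlam n (lam : ℂ) ⟨j + 1, hj⟩ l +
      lam * ToeplitzTlam n (lam : ℂ) ⟨j, by omega⟩ l =
      lam * (if (⟨j + 1, hj⟩ : Fin n) = l then 1 else 0) +
        if (⟨j, by omega⟩ : Fin n) = l then 1 else 0 := by
    rintro ⟨l, hl⟩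
    simp only [ToeplitzTlam, Fin.mk.injEq]
    rcases lt_trichotomy l j with h | h | h
    · obtain ⟨r, rfl⟩ := Nat.exists_eq_add_of_lt h
      have h1 : l + r + 1 + 1 - l - 1 = r + 1 := by omega
      have h2 : l + r + 1 - l - 1 = r := by omega
      rw [if_neg (by omega), if_pos (by omega), if_neg (by omega), if_pos (by omega),
        if_neg (by omega), if_neg (by omega), h1, h2]
      simp
      ring
    · subst h
      simp
      ring
    · rcases eq_or_lt_of_le (Nat.succ_le_of_lt h) with h | h
      · subst h
        simp
      · rw [if_neg (by omega), if_neg (by omega), if_neg (by omega), if_neg (by omega),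
          if_neg (by omega), if_neg (by omega)]
        simp
  simp only [Matrix.mulVec, dotProduct]
  rw [Finset.mul_sum, ← Finset.sum_add_distrib]
  simp only [← mul_assoc, ← add_mul, hentry]
  simp only [add_mul, Finset.sum_add_distrib, mul_assoc, ← Finset.mul_sum, ite_mul, one_mul,
    zero_mul, Finset.sum_ite_eq, Finset.mem_univ, if_true]

theorem eq_zero_of_toeplitz_pow_mulVec_last_eq_zero {lam : ℝ} (hlam : lam ∈ Set.Ioo (0 : ℝ) 1)
    {n : ℕ} {v : Fin (n + 1) → ℂ}
    (hv : ∀ k : ℕ, (ToeplitzTlam (n + 1) (lam : ℂ) ^ k).mulVec v (Fin.last n) = 0) : v = 0 := by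
  set T := ToeplitzTlam (n + 1) (lam : ℂ) with hT
  obtain ⟨M, hM⟩ := exists_norm_toeplitz_pow_mulVec_le hlam v
  have key : ∀ r : ℕ, ∀ j, (hj : j < n + 1) → j + r = n → ∀ k : ℕ,
      (T ^ k).mulVec v ⟨j, hj⟩ = 0 := by
    intro r
    induction r with
    | zero =>
      rintro j hj rfl k
      exact hv k
    | succ r ih =>
      intro j hj hjr
      have hnext := ih (j + 1) (by omega) (by omega)
      have hstep : ∀ k : ℕ, (T ^ k).mulVec v ⟨j, hj⟩ = lam * (T ^ (k + 1)).mulVec v ⟨j, hj⟩ := by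
        intro k
        have h := toeplitz_mulVec_recurrence (lam := lam) ((T ^ k).mulVec v) (j := j) (by omega)
        rw [← hT, Matrix.mulVec_mulVec, ← pow_succ', hnext, hnext, zero_add, mul_zero,
          zero_add] at h
        exact h.symm
      have hiter : ∀ s k : ℕ, (T ^ k).mulVec v ⟨j, hj⟩ =
          lam ^ s * (T ^ (k + s)).mulVec v ⟨j, hj⟩ := by
        intro s
        induction s with
        | zero => simp
        | succ s ihs =>
          intro k
          rw [ihs k, hstep (k + s), pow_succ (lam : ℂ) s, ← add_assoc, mul_assoc]
      intro k
      have hlim : Filter.Tendsto (fun s : ℕ => lam ^ s * M) Filter.atTop (nhds (0 * M)) :=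
        (tendsto_pow_atTop_nhds_zero_of_lt_one hlam.1.le hlam.2).mul_const M
      rw [zero_mul] at hlim
      refine norm_le_zero_iff.1 (ge_of_tendsto' hlim fun s => ?_)
      rw [hiter s k, norm_mul, norm_pow, Complex.norm_real, Real.norm_of_nonneg hlam.1.le]
      exact mul_le_mul_of_nonneg_left (hM _ _) (pow_nonneg hlam.1.le s)
  ext i
  have h := key (n - i) i i.is_lt (by omega) 0
  simpa using h

theorem isUnit_det_smul_one_sub_toeplitz {lam : ℝ} {ζ : ℂ} (h : ζ ≠ lam) (n : ℕ) :
    IsUnit (ζ • (1 : Matrix (Fin n) (Fin n) ℂ) - ToeplitzTlam n (lam : ℂ)).det := by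
  rw [Matrix.det_of_isLowerTriangular]
  · simp [ToeplitzTlam, sub_eq_zero, h]
  · intro i j hij
    have hij : (i : ℕ) < j := hij
    have hne : i ≠ j := fun h => by simp [h] at hij
    simp [ToeplitzTlam, hij.ne, hij.not_gt, hne]

/-- The coefficients of `s ↦ 1 / (1 - γ s)`, extended by zero to negative indices. -/
noncomputable def geomCoeff (γ : ℂ) (m : ℤ) : ℂ := if 0 ≤ m then γ ^ m else 0

theorem geomCoeff_sub_mul {γ : ℂ} (hγ : γ ≠ 0) (m : ℤ) :
    geomCoeff γ m - γ * geomCoeff γ (m - 1) = if m = 0 then 1 else 0 := by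
  rcases lt_trichotomy m 0 with h | rfl | h
  · simp [geomCoeff, h.not_ge, h.ne, show ¬ 1 ≤ m by omega]
  · simp [geomCoeff]
  · rw [geomCoeff, geomCoeff, if_pos h.le, if_pos (by omega), if_neg h.ne', ← zpow_one_add₀ hγ,
      add_sub_cancel, sub_self]

theorem mul_norm_le_norm_geomCoeff_sub {β : ℂ} (hβ0 : β ≠ 0) (m : ℕ) :
    ‖β‖ * (1 - ‖β‖ ^ 2) ≤
      ‖β‖ ^ (m + 1) * ‖geomCoeff β⁻¹ m - geomCoeff β⁻¹ ((m : ℤ) - 2)‖ := by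
  have hpos : 0 < ‖β‖ := norm_pos_iff.2 hβ0
  by_cases hm : m < 2
  · have : geomCoeff β⁻¹ ((m : ℤ) - 2) = 0 := by
      rw [geomCoeff, if_neg (by omega)]
    rw [this, sub_zero, geomCoeff, if_pos (by positivity), zpow_natCast, norm_pow, norm_inv,
      inv_pow, pow_succ _ m, mul_right_comm, mul_inv_cancel₀ (by positivity), one_mul]
    nlinarith [sq_nonneg ‖β‖]
  · obtain ⟨r, rfl⟩ := Nat.exists_eq_add_of_le (not_lt.1 hm)
    have h2 : ((2 + r : ℕ) : ℤ) - 2 = r := by push_cast; ring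
    have h3 : β⁻¹ ^ (2 + r) - β⁻¹ ^ r = β⁻¹ ^ (2 + r) * (1 - β ^ 2) := by
      rw [pow_add]
      field_simp
    rw [h2, geomCoeff, geomCoeff, if_pos (by positivity), if_pos (by positivity), zpow_natCast,
      zpow_natCast, h3, norm_mul, norm_pow, norm_inv, inv_pow, pow_succ _ (2 + r), mul_right_comm,
      ← mul_assoc, mul_inv_cancel₀ (by positivity), one_mul, mul_comm ‖β‖]
    gcongr
    have h := norm_sub_norm_le (1 : ℂ) (β ^ 2)
    rwa [norm_one, norm_pow] at h

theorem norm_blaschke_lt_one {lam : ℝ} (hlam : lam ∈ Set.Ioo (0 : ℝ) 1) {ζ : ℂ} (hζ : ‖ζ‖ < 1) :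
    ‖(ζ - lam) / (1 - lam * ζ)‖ < 1 := by
  have hne := one_sub_mul_ne_zero hlam hζ.le
  rw [norm_div, div_lt_one (norm_pos_iff.2 hne)]
  refine lt_of_pow_lt_pow_left₀ 2 (norm_nonneg _) ?_
  have hz : ζ.re ^ 2 + ζ.im ^ 2 < 1 := by
    have h := Complex.normSq_eq_norm_sq ζ
    rw [Complex.normSq_apply] at h
    nlinarith [norm_nonneg ζ]
  rw [← Complex.normSq_eq_norm_sq, ← Complex.normSq_eq_norm_sq, Complex.normSq_apply,
    Complex.normSq_apply]
  simp
  nlinarith [mul_pos (sub_pos.2 hz) (by nlinarith [hlam.1, hlam.2] : 0 < 1 - lam ^ 2)]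

theorem circleCoeff_one_sub_sq (m : ℤ) : circleCoeff (fun z => 1 - z ^ 2) m =
    2 * π * Complex.I * ((if m = 0 then 1 else 0) - if m - 2 = 0 then 1 else 0) := by
  have h : circleCoeff (fun z => 1 - z ^ 2) m =
      circleCoeff (fun z => z ^ 0) m - circleCoeff (fun z => z ^ 2) m := by
    simp only [circleCoeff, sub_mul, pow_zero]
    exact circleIntegral.integral_sub
      (circleIntegrable_mul_zpow continuousOn_const _)
      (circleIntegrable_mul_zpow (by fun_prop) _)
  rw [h, circleCoeff_pow, circleCoeff_pow]
  simp [sub_eq_zero, mul_sub]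

theorem smul_one_sub_toeplitz_mulVec_geomCoeff {lam : ℝ} (hlam : lam ∈ Set.Ioo (0 : ℝ) 1) {ζ : ℂ}
    (hζ : ‖ζ‖ < 1) (hne : ζ ≠ lam) (n : ℕ) :
    (ζ • (1 : Matrix (Fin n) (Fin n) ℂ) - ToeplitzTlam n (lam : ℂ)).mulVec (fun i : Fin n =>
      2 * π * Complex.I / (ζ - lam) * (geomCoeff ((ζ - lam) / (1 - lam * ζ))⁻¹ (i : ℕ) -
        geomCoeff ((ζ - lam) / (1 - lam * ζ))⁻¹ (((i : ℕ) : ℤ) - 2))) =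
    fun i : Fin n => circleCoeff (fun z => (1 - z ^ 2) / (1 + lam * z)) (i : ℕ) := by
  have hden := one_sub_mul_ne_zero hlam hζ.le
  have hsub : ζ - lam ≠ 0 := sub_ne_zero.2 hne
  set γ := ((ζ - lam) / (1 - lam * ζ))⁻¹ with hγ_def
  have hγ : γ ≠ 0 := inv_ne_zero (div_ne_zero hsub hden)
  have hγmul : (ζ - lam) * γ = 1 - lam * ζ := by
    rw [hγ_def]
    field_simp
  have hf : DifferentiableOn ℂ (fun z : ℂ => (1 - z ^ 2) / (1 + lam * z))
      (Metric.closedBall 0 1) :=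
    DifferentiableOn.fun_div (by fun_prop) (by fun_prop) fun z hz =>
      one_add_mul_ne_zero hlam (by simpa using hz)
  set y : ℤ → ℂ := fun m => 2 * π * Complex.I / (ζ - lam) * (geomCoeff γ m - geomCoeff γ (m - 2))
    with hy
  set x : ℤ → ℂ := circleCoeff (fun z => (1 - z ^ 2) / (1 + lam * z)) with hx
  have hy1 : y (-1) = 0 := by simp [hy, geomCoeff]
  have hx1 : x (-1) = 0 := circleCoeff_neg_one hf
  have hrec : ∀ m : ℤ, (ζ - lam) * (y m - γ * y (m - 1)) = x m + lam * x (m - 1) := by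
    intro m
    have h := circleCoeff_affine_mul (hf.continuousOn.mono Metric.sphere_subset_closedBall) 1 lam m
    rw [one_mul, circleCoeff_congr (g := fun z => 1 - z ^ 2), circleCoeff_one_sub_sq,
      ← geomCoeff_sub_mul hγ, ← geomCoeff_sub_mul hγ] at h
    · rw [← h]
      simp only [hy, show m - 1 - 2 = m - 2 - 1 by ring]
      field_simp
      ring
    · intro z hz
      have := one_add_mul_ne_zero hlam hz.le
      field_simp
  have hT := toeplitz_mulVec_eq (lam := lam) (u := fun m => ζ * y m - x m) (v := y)
    (by simp [hy1, hx1]) hy1 (fun m => by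
      have h := hrec m
      linear_combination h + y (m - 1) * hγmul) n
  rw [Matrix.sub_mulVec, Matrix.smul_mulVec, Matrix.one_mulVec]
  refine (congrArg _ hT).trans ?_
  ext i
  simp [hy]

/-- For λ ∈ (0,1) and ζ ∈ 𝔻 with ζ ≠ λ there is d = d(λ,ζ) > 0 such that for
every n ≥ 1 there exists a norm N on ℂⁿ whose induced operator norm satisfies ‖T_λ‖ ≤ 1 and
|b_λ(ζ)|ⁿ·‖(ζI − T_λ)⁻¹‖ ≥ d·√n (the operator-norm lower bound being witnessed at some
x ≠ 0, as it is attained in finite dimension). -/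
theorem toeplitz_resolvent_lower_bound
    (lam : ℝ) (hlam : lam ∈ Set.Ioo (0 : ℝ) 1)
    (ζ : ℂ) (hζ : ‖ζ‖ < 1) (hζlam : ζ ≠ (lam : ℂ)) :
    ∃ d : ℝ, 0 < d ∧ ∀ n : ℕ, 1 ≤ n →
      ∃ N : Seminorm ℂ (Fin n → ℂ),
        (∀ x, N x = 0 → x = 0) ∧
        (∀ x, N ((ToeplitzTlam n (lam : ℂ)).mulVec x) ≤ N x) ∧
        (∃ x : Fin n → ℂ, x ≠ 0 ∧
          d * Real.sqrt n * N x ≤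
            ‖(ζ - (lam : ℂ)) / (1 - (lam : ℂ) * ζ)‖ ^ n *
              N (((ζ • (1 : Matrix (Fin n) (Fin n) ℂ) - ToeplitzTlam n (lam : ℂ))⁻¹).mulVec x)) := by
  obtain ⟨K, hK, hbound⟩ := exists_norm_circleCoeff_le hlam
  have hden := one_sub_mul_ne_zero hlam hζ.le
  have hsub : ζ - lam ≠ 0 := sub_ne_zero.2 hζlam
  have hβ0 : (ζ - lam) / (1 - lam * ζ) ≠ 0 := div_ne_zero hsub hden
  have hβ1 := norm_blaschke_lt_one hlam hζ
  have hy_eq := smul_one_sub_toeplitz_mulVec_geomCoeff hlam hζ hζlam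
  set β := (ζ - lam) / (1 - lam * ζ) with hβ
  have hβpos : 0 < ‖β‖ := norm_pos_iff.2 hβ0
  set κ : ℂ := 2 * π * Complex.I / (ζ - lam) with hκ
  have hκ0 : 0 < ‖κ‖ := norm_pos_iff.2 (div_ne_zero Complex.two_pi_I_ne_zero hsub)
  have hc : 0 < ‖κ‖ * (‖β‖ * (1 - ‖β‖ ^ 2)) := by
    have : 0 < 1 - ‖β‖ ^ 2 := by nlinarith
    positivity
  have hf : DifferentiableOn ℂ (fun z : ℂ => (1 - z ^ 2) / (1 + lam * z))
      (Metric.closedBall 0 1) :=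
    DifferentiableOn.fun_div (by fun_prop) (by fun_prop) fun z hz =>
      one_add_mul_ne_zero hlam (by simpa using hz)
  refine ⟨‖κ‖ * (‖β‖ * (1 - ‖β‖ ^ 2)) / K, by positivity, fun n hn => ?_⟩
  obtain ⟨m, rfl⟩ := Nat.exists_eq_add_of_le' hn
  set T := ToeplitzTlam (m + 1) (lam : ℂ) with hT
  have hA : ∀ v, ∃ M : ℝ, ∀ k : ℕ, ‖(T ^ k).mulVec v (Fin.last m)‖ ≤ M := fun v =>
    (exists_norm_toeplitz_pow_mulVec_le hlam v).imp fun M hM k => hM k _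
  set y : Fin (m + 1) → ℂ := fun i =>
    κ * (geomCoeff β⁻¹ (i : ℕ) - geomCoeff β⁻¹ (((i : ℕ) : ℤ) - 2)) with hy
  have hinv : ((ζ • (1 : Matrix (Fin (m + 1)) (Fin (m + 1)) ℂ) - T)⁻¹).mulVec
      ((ζ • (1 : Matrix (Fin (m + 1)) (Fin (m + 1)) ℂ) - T).mulVec y) = y := by
    rw [Matrix.mulVec_mulVec, Matrix.nonsing_inv_mul _ (isUnit_det_smul_one_sub_toeplitz hζlam _),
      Matrix.one_mulVec]
  have hylast : ‖κ‖ * (‖β‖ * (1 - ‖β‖ ^ 2)) ≤ ‖β‖ ^ (m + 1) * ‖y (Fin.last m)‖ := by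
    rw [hy, norm_mul, mul_left_comm (‖β‖ ^ (m + 1))]
    exact mul_le_mul_of_nonneg_left (mul_norm_le_norm_geomCoeff_sub hβ0 m) hκ0.le
  refine ⟨orbitSeminorm T (Fin.last m) hA, fun v hv => ?_, orbitSeminorm_mulVec_le,
    (ζ • (1 : Matrix (Fin (m + 1)) (Fin (m + 1)) ℂ) - T).mulVec y, fun h0 => ?_, ?_⟩
  · refine eq_zero_of_toeplitz_pow_mulVec_last_eq_zero hlam fun k => norm_le_zero_iff.1 ?_
    exact (norm_pow_mulVec_le_orbitSeminorm v k).trans hv.le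
  · rw [h0, Matrix.mulVec_zero] at hinv
    rw [← hinv, Pi.zero_apply, norm_zero, mul_zero] at hylast
    exact hylast.not_gt hc
  · rw [hinv]
    have hNx : orbitSeminorm T (Fin.last m) hA
        ((ζ • (1 : Matrix (Fin (m + 1)) (Fin (m + 1)) ℂ) - T).mulVec y) ≤ K / √(m + 1) := by
      refine orbitSeminorm_le fun k => ?_
      rw [hy, hy_eq, toeplitz_pow_mulVec_circleCoeff hlam hf]
      exact hbound k m
    have hNy : ‖y (Fin.last m)‖ ≤ orbitSeminorm T (Fin.last m) hA y := by
      simpa using norm_pow_mulVec_le_orbitSeminorm (hA := hA) y 0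
    calc _ ≤ ‖κ‖ * (‖β‖ * (1 - ‖β‖ ^ 2)) / K * √((m + 1 : ℕ) : ℝ) * (K / √(m + 1)) := by gcongr
      _ = ‖κ‖ * (‖β‖ * (1 - ‖β‖ ^ 2)) := by
        push_cast
        field_simp
      _ ≤ ‖β‖ ^ (m + 1) * ‖y (Fin.last m)‖ := hylast
      _ ≤ _ := by gcongr
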